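/- Every Hermitian matrix A ∈ ℂ^{2^n × 2^n} has a unique expansion A = Σ_P c_P · P with real coefficients c_P over the 4^n Pauli terms P (n-fold tensor products of I, X, Y, Z); a Pauli term is odd-local if the number of its non-identity tensor factors is odd. Let A⁻ be obtained from A by negating c_P for every odd-local Pauli term P. Then for every positive semidefinite Hermitian ρ ∈ ℂ^{2^n × 2^n}, the matrix ρ⁻ is also positive semidefinite, and tr(ρ⁻) = tr(ρ). -/

import Mathlib

open scoped ComplexOrder

/-- The Pauli `X` matrix. -/
noncomputable def PauliX : Matrix (Fin 2) (Fin 2) ℂ := !![0, 1; 1, 0]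

/-- The Pauli `Y` matrix. -/
noncomputable def PauliY : Matrix (Fin 2) (Fin 2) ℂ := !![0, -Complex.I; Complex.I, 0]

/-- The Pauli `Z` matrix. -/
noncomputable def PauliZ : Matrix (Fin 2) (Fin 2) ℂ := !![1, 0; 0, -1]

/-- The four single-qubit Pauli matrices `I, X, Y, Z`, indexed by `Fin 4`. -/
noncomputable def pauliMat : Fin 4 → Matrix (Fin 2) (Fin 2) ℂ :=
  ![1, PauliX, PauliY, PauliZ]

/-- The `n`-qubit Pauli term indexed by `p : Fin n → Fin 4`: the Kronecker product of the
single-qubit Pauli matrices `pauliMat (p i)`, as a matrix on `(ℂ²)^{⊗n}` indexed by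
computational basis states `Fin n → Fin 2`. -/
noncomputable def pauliTerm {n : ℕ} (p : Fin n → Fin 4) :
    Matrix (Fin n → Fin 2) (Fin n → Fin 2) ℂ :=
  Matrix.of fun s t => ∏ i, pauliMat (p i) (s i) (t i)

/-- The sign `(-1)^{[p is odd-local]}`: `-1` if the Pauli term `p` has an odd number of
non-identity tensor factors, and `1` otherwise. -/
noncomputable def pauliSign {n : ℕ} (p : Fin n → Fin 4) : ℝ :=
  if Odd (Finset.univ.filter fun i => p i ≠ 0).card then -1 else 1

/-- The Kronecker product of a finite family of square matrices. -/
def piKronecker {ι κ R : Type*} [Fintype ι] [CommSemiring R] (M : ι → Matrix κ κ R) :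
    Matrix (ι → κ) (ι → κ) R :=
  Matrix.of fun s t => ∏ i, M i (s i) (t i)

section piKronecker

variable {ι κ R : Type*} [Fintype ι] [CommSemiring R]

theorem piKronecker_transpose (M : ι → Matrix κ κ R) :
    (piKronecker M).transpose = piKronecker fun i => (M i).transpose :=
  rfl

theorem piKronecker_conjTranspose [StarRing R] (M : ι → Matrix κ κ R) :
    (piKronecker M).conjTranspose = piKronecker fun i => (M i).conjTranspose := by
  ext s t
  simp [piKronecker, Matrix.conjTranspose_apply, star_prod]

theorem piKronecker_smul (a : ι → R) (M : ι → Matrix κ κ R) :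
    (piKronecker fun i => a i • M i) = (∏ i, a i) • piKronecker M := by
  ext s t
  simp [piKronecker, Finset.prod_mul_distrib]

theorem piKronecker_mul [DecidableEq ι] [Fintype κ] (M N : ι → Matrix κ κ R) :
    piKronecker M * piKronecker N = piKronecker fun i => M i * N i := by
  ext s t
  simp only [piKronecker, Matrix.mul_apply, Matrix.of_apply, ← Finset.prod_mul_distrib]
  rw [Finset.prod_univ_sum, Fintype.piFinset_univ]

theorem piKronecker_trace [DecidableEq ι] [Fintype κ] (M : ι → Matrix κ κ R) :
    (piKronecker M).trace = ∏ i, (M i).trace := by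
  simp only [piKronecker, Matrix.trace, Matrix.diag_apply, Matrix.of_apply]
  rw [Finset.prod_univ_sum, Fintype.piFinset_univ]

theorem piKronecker_one [DecidableEq κ] :
    (piKronecker fun _ : ι => (1 : Matrix κ κ R)) = 1 := by
  ext s t
  simp [piKronecker, Matrix.one_apply, Fintype.prod_ite_zero, funext_iff]

end piKronecker

theorem pauliTerm_eq_piKronecker {n : ℕ} (p : Fin n → Fin 4) :
    pauliTerm p = piKronecker fun i => pauliMat (p i) :=
  rfl

theorem pauliMat_conjTranspose (a : Fin 4) : (pauliMat a).conjTranspose = pauliMat a := by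
  ext i j
  fin_cases a <;> fin_cases i <;> fin_cases j <;>
    simp [pauliMat, PauliX, PauliY, PauliZ, Matrix.conjTranspose_apply]

theorem trace_pauliMat_mul (a b : Fin 4) :
    (pauliMat a * pauliMat b).trace = if a = b then 2 else 0 := by
  fin_cases a <;> fin_cases b <;>
    simp [pauliMat, PauliX, PauliY, PauliZ, Matrix.trace_fin_two, one_add_one_eq_two]

theorem sum_pauliMat_mul_pauliMat (s t u v : Fin 2) :
    ∑ a, pauliMat a s t * pauliMat a u v = if s = v ∧ t = u then 2 else 0 := by
  fin_cases s <;> fin_cases t <;> fin_cases u <;> fin_cases v <;>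
    simp [pauliMat, PauliX, PauliY, PauliZ, Fin.sum_univ_four, one_add_one_eq_two]

theorem pauliY_mul_self : PauliY * PauliY = 1 := by
  ext i j
  fin_cases i <;> fin_cases j <;> simp [PauliY]

theorem pauliY_conjTranspose : PauliY.conjTranspose = PauliY :=
  pauliMat_conjTranspose 2

/-- The single-qubit spin flip negates the non-identity Pauli matrices. -/
theorem pauliY_mul_transpose_mul_pauliY (a : Fin 4) :
    PauliY * (pauliMat a).transpose * PauliY = (if a ≠ 0 then (-1 : ℂ) else 1) • pauliMat a := by
  ext i j
  fin_cases a <;> fin_cases i <;> fin_cases j <;>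
    simp [pauliMat, PauliX, PauliY, PauliZ, Matrix.mul_apply, Matrix.vecMul, dotProduct]

theorem pauliTerm_isHermitian {n : ℕ} (p : Fin n → Fin 4) : (pauliTerm p).IsHermitian := by
  simp only [Matrix.IsHermitian, pauliTerm_eq_piKronecker, piKronecker_conjTranspose,
    pauliMat_conjTranspose]

theorem trace_pauliTerm_mul {n : ℕ} (p q : Fin n → Fin 4) :
    (pauliTerm p * pauliTerm q).trace = if p = q then 2 ^ n else 0 := by
  simp [pauliTerm_eq_piKronecker, piKronecker_mul, piKronecker_trace, trace_pauliMat_mul,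
    Fintype.prod_ite_zero, funext_iff]

theorem sum_pauliTerm_mul_pauliTerm {n : ℕ} (s t u v : Fin n → Fin 2) :
    ∑ p : Fin n → Fin 4, pauliTerm p s t * pauliTerm p u v =
      if s = v ∧ t = u then 2 ^ n else 0 := by
  simp only [pauliTerm, Matrix.of_apply, ← Finset.prod_mul_distrib]
  have h := Finset.prod_univ_sum (fun _ : Fin n => (Finset.univ : Finset (Fin 4)))
    (fun i a => pauliMat a (s i) (t i) * pauliMat a (u i) (v i))
  rw [Fintype.piFinset_univ] at h
  rw [← h]
  simp [sum_pauliMat_mul_pauliMat, Fintype.prod_ite_zero, funext_iff, forall_and]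

/-- Completeness of the Pauli terms. -/
theorem sum_trace_smul_pauliTerm {n : ℕ} (A : Matrix (Fin n → Fin 2) (Fin n → Fin 2) ℂ) :
    ∑ p : Fin n → Fin 4, (pauliTerm p * A).trace • pauliTerm p = (2 ^ n : ℂ) • A := by
  ext s t
  simp only [Matrix.sum_apply, Matrix.smul_apply, smul_eq_mul, Matrix.trace, Matrix.diag_apply,
    Matrix.mul_apply, Finset.sum_mul]
  rw [Finset.sum_comm]
  simp_rw [Finset.sum_comm (s := (Finset.univ : Finset (Fin n → Fin 4)))]
  have h (u v : Fin n → Fin 2) :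
      ∑ p : Fin n → Fin 4, pauliTerm p u v * A v u * pauliTerm p s t =
        if s = v ∧ t = u then 2 ^ n * A v u else 0 := by
    rw [← ite_zero_mul, ← sum_pauliTerm_mul_pauliTerm, Finset.sum_mul]
    exact Finset.sum_congr rfl fun _ _ => by ring
  simp [h, ite_and]

theorem trace_pauliTerm_mul_sum {n : ℕ} (c : (Fin n → Fin 4) → ℂ) (q : Fin n → Fin 4) :
    (pauliTerm q * ∑ p : Fin n → Fin 4, c p • pauliTerm p).trace = 2 ^ n * c q := by
  simp [Finset.mul_sum, Matrix.trace_sum, trace_pauliTerm_mul, mul_comm]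

theorem trace_pauliTerm_mul_eq_ofReal_re {n : ℕ} (p : Fin n → Fin 4)
    {A : Matrix (Fin n → Fin 2) (Fin n → Fin 2) ℂ} (hA : A.IsHermitian) :
    (((pauliTerm p * A).trace.re : ℝ) : ℂ) = (pauliTerm p * A).trace := by
  rw [← Complex.conj_eq_iff_re, starRingEnd_apply, ← Matrix.trace_conjTranspose,
    Matrix.conjTranspose_mul, hA.eq, (pauliTerm_isHermitian p).eq, Matrix.trace_mul_comm]

theorem existsUnique_eq_sum_pauliTerm {n : ℕ} {A : Matrix (Fin n → Fin 2) (Fin n → Fin 2) ℂ}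
    (hA : A.IsHermitian) :
    ∃! c : (Fin n → Fin 4) → ℝ, A = ∑ p : Fin n → Fin 4, (c p : ℂ) • pauliTerm p := by
  have h2 : (2 ^ n : ℂ) ≠ 0 := by positivity
  refine ⟨fun p => (2 ^ n)⁻¹ * (pauliTerm p * A).trace.re, ?_, fun c hc => ?_⟩
  · simp only [Complex.ofReal_mul, trace_pauliTerm_mul_eq_ofReal_re _ hA, mul_smul,
      ← Finset.smul_sum, sum_trace_smul_pauliTerm]
    simp [smul_smul, h2]
  · funext p
    apply Complex.ofReal_injective
    have h := trace_pauliTerm_mul_sum (fun p => (c p : ℂ)) p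
    rw [← hc] at h
    rw [Complex.ofReal_mul, trace_pauliTerm_mul_eq_ofReal_re _ hA, h]
    simp [h2]

/-- The spin flip `A ↦ Y^{⊗n} Aᵀ Y^{⊗n}`. -/
noncomputable def spinFlip {n : ℕ} (A : Matrix (Fin n → Fin 2) (Fin n → Fin 2) ℂ) :
    Matrix (Fin n → Fin 2) (Fin n → Fin 2) ℂ :=
  (piKronecker fun _ => PauliY) * A.transpose * piKronecker fun _ => PauliY

theorem prod_ite_eq_pauliSign {n : ℕ} (p : Fin n → Fin 4) :
    (∏ i, if p i ≠ 0 then (-1 : ℂ) else 1) = (pauliSign p : ℂ) := by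
  rw [Finset.prod_ite, Finset.prod_const, Finset.prod_const_one, mul_one, pauliSign]
  split_ifs with h
  · simp [h.neg_one_pow]
  · simp [(Nat.not_odd_iff_even.mp h).neg_one_pow]

theorem spinFlip_pauliTerm {n : ℕ} (p : Fin n → Fin 4) :
    spinFlip (pauliTerm p) = (pauliSign p : ℂ) • pauliTerm p := by
  simp only [spinFlip, pauliTerm_eq_piKronecker, piKronecker_transpose, piKronecker_mul,
    pauliY_mul_transpose_mul_pauliY, piKronecker_smul, prod_ite_eq_pauliSign]

theorem spinFlip_sum_pauliTerm {n : ℕ} (c : (Fin n → Fin 4) → ℝ) :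
    spinFlip (∑ p : Fin n → Fin 4, (c p : ℂ) • pauliTerm p) =
      ∑ p : Fin n → Fin 4, ((pauliSign p * c p : ℝ) : ℂ) • pauliTerm p := by
  rw [spinFlip, Matrix.transpose_sum, Finset.mul_sum, Finset.sum_mul]
  refine Finset.sum_congr rfl fun p _ => ?_
  rw [Matrix.transpose_smul, Matrix.mul_smul, Matrix.smul_mul, ← spinFlip, spinFlip_pauliTerm,
    smul_smul, Complex.ofReal_mul, mul_comm]

theorem Matrix.PosSemidef.spinFlip {n : ℕ} {A : Matrix (Fin n → Fin 2) (Fin n → Fin 2) ℂ}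
    (hA : A.PosSemidef) : (spinFlip A).PosSemidef := by
  have h := hA.transpose.mul_mul_conjTranspose_same (piKronecker fun _ => PauliY)
  rwa [piKronecker_conjTranspose, pauliY_conjTranspose] at h

theorem trace_spinFlip {n : ℕ} (A : Matrix (Fin n → Fin 2) (Fin n → Fin 2) ℂ) :
    (spinFlip A).trace = A.trace := by
  rw [spinFlip, Matrix.trace_mul_comm, ← mul_assoc, piKronecker_mul, pauliY_mul_self,
    piKronecker_one, one_mul, Matrix.trace_transpose]

/-- every Hermitian `A ∈ ℂ^{2^n × 2^n}` has a unique expansion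
`A = Σ_P c_P P` with real coefficients over the `4^n` Pauli terms, and for any positive
semidefinite `ρ` with expansion coefficients `c`, the matrix `ρ⁻` obtained by negating the
coefficients of all odd-local Pauli terms is also positive semidefinite and has the same
trace as `ρ`. -/
theorem stmt_18 (n : ℕ) :
    (∀ A : Matrix (Fin n → Fin 2) (Fin n → Fin 2) ℂ, A.IsHermitian →
      ∃! c : (Fin n → Fin 4) → ℝ,
        A = ∑ p : Fin n → Fin 4, (c p : ℂ) • pauliTerm p) ∧
    (∀ (ρ : Matrix (Fin n → Fin 2) (Fin n → Fin 2) ℂ) (c : (Fin n → Fin 4) → ℝ),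
      ρ.PosSemidef → ρ = ∑ p : Fin n → Fin 4, (c p : ℂ) • pauliTerm p →
        (∑ p : Fin n → Fin 4, ((pauliSign p * c p : ℝ) : ℂ) • pauliTerm p).PosSemidef ∧
        (∑ p : Fin n → Fin 4, ((pauliSign p * c p : ℝ) : ℂ) • pauliTerm p).trace
          = ρ.trace) := by
  refine ⟨fun A hA => existsUnique_eq_sum_pauliTerm hA, fun ρ c hρ hc => ?_⟩
  rw [← spinFlip_sum_pauliTerm, ← hc]
  exact ⟨hρ.spinFlip, trace_spinFlip ρ⟩
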